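/- Let (Ω, μ) be a measure space, N ≥ 1, and let ε ∈ (0, 1/2] and b, c > 0 be constants. Let ψ : ℝ → ℝ satisfy 0 ≤ ψ ≤ 1, ψ(t) = 0 for t ≤ 0 and ψ(t) = 1 for t ≥ 1, and set ψ_ε = (1 - ε²)ψ + ε². Let W : ℝ → ℝ be nonnegative with W(0) = W(1) = 0. Let G : Ω → ℝ^N and v̂ : Ω → ℝ be measurable, and set ṽ(x) = max(min(v̂(x), 1), 0). If the function x ↦ b ψ_ε(1 - v̂(x))‖G(x)‖² + (c²/ε) W(1 - v̂(x)) is integrable, then x ↦ b ψ_ε(1 - ṽ(x))‖G(x)‖² + (c²/ε) W(1 - ṽ(x)) is integrable and ∫_Ω ( b ψ_ε(1 - ṽ)‖G‖² + (c²/ε) W(1 - ṽ) ) dμ ≤ ∫_Ω ( b ψ_ε(1 - v̂)‖G‖² + (c²/ε) W(1 - v̂) ) dμ. -/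

import Mathlib

open MeasureTheory

/-- Truncation of the phase-field does not increase the weighted energy plus the
double-well potential term of the functional `G_ε`. -/
theorem doubleWell_energy_truncation_le {Ω : Type*} [MeasurableSpace Ω] (μ : Measure Ω)
    (N : ℕ) (hN : 1 ≤ N) (ε b c : ℝ) (hε : ε ∈ Set.Ioc (0 : ℝ) (1 / 2))
    (hb : 0 < b) (hc : 0 < c)
    (ψ : ℝ → ℝ) (hψ01 : ∀ t, 0 ≤ ψ t ∧ ψ t ≤ 1)
    (hψ0 : ∀ t ≤ (0 : ℝ), ψ t = 0) (hψ1 : ∀ t : ℝ, 1 ≤ t → ψ t = 1)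
    (ψε : ℝ → ℝ) (hψε : ψε = fun t => (1 - ε ^ 2) * ψ t + ε ^ 2)
    (W : ℝ → ℝ) (hW : ∀ t, 0 ≤ W t) (hW0 : W 0 = 0) (hW1 : W 1 = 0)
    (G : Ω → EuclideanSpace ℝ (Fin N)) (hG : Measurable G)
    (vhat : Ω → ℝ) (hvhat : Measurable vhat)
    (vtil : Ω → ℝ) (hvtil : vtil = fun x => max (min (vhat x) 1) 0)
    (hint : Integrable
      (fun x => b * ψε (1 - vhat x) * ‖G x‖ ^ 2 + c ^ 2 / ε * W (1 - vhat x)) μ) :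
    Integrable
      (fun x => b * ψε (1 - vtil x) * ‖G x‖ ^ 2 + c ^ 2 / ε * W (1 - vtil x)) μ ∧
    ∫ x, (b * ψε (1 - vtil x) * ‖G x‖ ^ 2 + c ^ 2 / ε * W (1 - vtil x)) ∂μ ≤
      ∫ x, (b * ψε (1 - vhat x) * ‖G x‖ ^ 2 + c ^ 2 / ε * W (1 - vhat x)) ∂μ := by
  classical
  obtain ⟨hε0, -⟩ := hε
  have hlow : ∀ x, vhat x < 0 →
      b * ψε (1 - vtil x) * ‖G x‖ ^ 2 + c ^ 2 / ε * W (1 - vtil x) = b * ‖G x‖ ^ 2 ∧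
      b * ψε (1 - vhat x) * ‖G x‖ ^ 2 = b * ‖G x‖ ^ 2 := by
    intro x hx
    have hv : vtil x = 0 := by
      simp only [hvtil]
      exact max_eq_right ((min_le_left _ _).trans hx.le)
    have h1 : ψ (1 - vhat x) = 1 := hψ1 _ (by linarith)
    simp [hv, hψε, h1, hψ1 1 le_rfl, hW1]
  have hhigh : ∀ x, 1 < vhat x →
      b * ψε (1 - vtil x) * ‖G x‖ ^ 2 + c ^ 2 / ε * W (1 - vtil x)
        = b * ε ^ 2 * ‖G x‖ ^ 2 ∧
      b * ψε (1 - vhat x) * ‖G x‖ ^ 2 = b * ε ^ 2 * ‖G x‖ ^ 2 := by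
    intro x hx
    have hv : vtil x = 1 := by
      simp [hvtil, min_eq_right hx.le]
    have h1 : ψ (1 - vhat x) = 0 := hψ0 _ (by linarith)
    simp [hv, hψε, h1, hψ0 0 le_rfl, hW0]
  have hmid : ∀ x, 0 ≤ vhat x → vhat x ≤ 1 → vtil x = vhat x := by
    intro x h0 h1
    simp [hvtil, min_eq_left h1, max_eq_left h0]
  have hWnonneg : ∀ x, 0 ≤ c ^ 2 / ε * W (1 - vhat x) := fun x =>
    mul_nonneg (by positivity) (hW _)
  have hle : ∀ x, b * ψε (1 - vtil x) * ‖G x‖ ^ 2 + c ^ 2 / ε * W (1 - vtil x) ≤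
      b * ψε (1 - vhat x) * ‖G x‖ ^ 2 + c ^ 2 / ε * W (1 - vhat x) := by
    intro x
    rcases lt_or_ge (vhat x) 0 with h0 | h0
    · linarith [hlow x h0, hWnonneg x]
    rcases lt_or_ge 1 (vhat x) with h1 | h1
    · linarith [hhigh x h1, hWnonneg x]
    · rw [hmid x h0 h1]
  have hnonneg : ∀ x,
      0 ≤ b * ψε (1 - vtil x) * ‖G x‖ ^ 2 + c ^ 2 / ε * W (1 - vtil x) := by
    intro x
    have hψpos : 0 ≤ ψε (1 - vtil x) := by
      rw [hψε]
      nlinarith [hψ01 (1 - vtil x), sq_nonneg ε]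
    exact add_nonneg (by positivity) (mul_nonneg (by positivity) (hW _))
  have hpiecewise :
      (fun x => b * ψε (1 - vtil x) * ‖G x‖ ^ 2 + c ^ 2 / ε * W (1 - vtil x)) =
      {x | vhat x < 0}.piecewise (fun x => b * ‖G x‖ ^ 2)
        ({x | 1 < vhat x}.piecewise (fun x => b * ε ^ 2 * ‖G x‖ ^ 2)
          (fun x => b * ψε (1 - vhat x) * ‖G x‖ ^ 2 + c ^ 2 / ε * W (1 - vhat x))) := by
    funext x
    by_cases h0 : vhat x < 0
    · simpa [Set.piecewise, h0] using (hlow x h0).1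
    by_cases h1 : 1 < vhat x
    · simpa [Set.piecewise, h0, h1] using (hhigh x h1).1
    · simp [Set.piecewise, h0, h1, hmid x (not_lt.mp h0) (not_lt.mp h1)]
  have hmeas : AEStronglyMeasurable
      (fun x => b * ψε (1 - vtil x) * ‖G x‖ ^ 2 + c ^ 2 / ε * W (1 - vtil x)) μ := by
    rw [hpiecewise]
    refine AEStronglyMeasurable.piecewise (measurableSet_lt hvhat measurable_const) ?_
      (AEStronglyMeasurable.piecewise (measurableSet_lt measurable_const hvhat) ?_
        hint.aestronglyMeasurable.restrict).restrict
    · exact ((hG.norm.pow_const 2).const_mul b).aestronglyMeasurable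
    · exact ((hG.norm.pow_const 2).const_mul (b * ε ^ 2)).aestronglyMeasurable
  have hint' := hint.mono' hmeas <| Filter.Eventually.of_forall fun x => by
    rw [Real.norm_of_nonneg (hnonneg x)]
    exact hle x
  exact ⟨hint', integral_mono hint' hint hle⟩
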